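/- Let S be a compact convex subset of a Euclidean space whose affine hull is 3-dimensional. Then the group of bijective affine transformations of S acts transitively on the set of extreme points of S if and only if S is affinely isomorphic to one of: a 3-dimensional vertex-transitive convex polytope, the circular cylinder {(x,y,z) : x²+y²≤1, 0≤z≤1}, or the closed 3-dimensional unit ball. -/

import Mathlib

noncomputable section

/-- `S` is affinely isomorphic to `T`: there is a bijective affine map from `S` onto `T`. -/
def AffIso {E F : Type*} [NormedAddCommGroup E] [NormedSpace ℝ E]
    [NormedAddCommGroup F] [NormedSpace ℝ F] (S : Set E) (T : Set F) : Prop :=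
  ∃ f : E →ᵃ[ℝ] F, Set.InjOn f S ∧ f '' S = T

/-- The group of bijective affine transformations of `S` acts transitively on the set of
extreme points of `S`. -/
def AutTransitiveOnExtreme {E : Type*} [NormedAddCommGroup E] [NormedSpace ℝ E]
    (S : Set E) : Prop :=
  ∀ x ∈ Set.extremePoints ℝ S, ∀ y ∈ Set.extremePoints ℝ S,
    ∃ f : E ≃ᵃ[ℝ] E, f '' S = S ∧ f x = y

open Filter Topology Set

section IsometryGroup

variable {V : Type*} [NormedAddCommGroup V] [InnerProductSpace ℝ V]

lemma interior_hyperplane_eq_empty {w : V} (hw : w ≠ 0) (h : ℝ) :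
    interior {p : V | inner ℝ p w = h} = ∅ := by
  refine eq_empty_of_forall_notMem fun x hx => ?_
  have h1 : ∀ᶠ t : ℝ in 𝓝 0, inner ℝ (x + t • w) w = h := by
    have hcont : Tendsto (fun t : ℝ => x + t • w) (𝓝 0) (𝓝 x) := by
      have : Continuous fun t : ℝ => x + t • w := by fun_prop
      simpa using this.tendsto 0
    exact hcont.eventually (mem_interior_iff_mem_nhds.1 hx)
  obtain ⟨t, ht, ht0⟩ := ((h1.filter_mono nhdsWithin_le_nhds).and
    (self_mem_nhdsWithin : {(0 : ℝ)}ᶜ ∈ 𝓝[≠] (0 : ℝ))).exists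
  have h2 : x ∈ {p : V | inner ℝ p w = h} := interior_subset hx
  rw [mem_ofPred_eq] at h2
  rw [inner_add_left, real_inner_smul_left, h2, real_inner_self_eq_norm_sq] at ht
  have : t * ‖w‖ ^ 2 = 0 := by linarith
  rcases mul_eq_zero.1 this with h3 | h3
  · exact ht0 h3
  · exact hw (by simpa using h3)

lemma tendsto_one_of_tendsto_rescaled {g : ℕ → V →L[ℝ] V} {ε : ℕ → ℝ} {A : V →L[ℝ] V}
    (hε : ∀ n, 0 < ε n) (h0 : Tendsto ε atTop (𝓝 0))
    (hA : Tendsto (fun n => (ε n)⁻¹ • (g n - 1)) atTop (𝓝 A)) : Tendsto g atTop (𝓝 1) := by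
  have h := (h0.smul hA).add_const 1
  simp only [zero_smul, zero_add] at h
  refine h.congr fun n => ?_
  rw [smul_smul, mul_inv_cancel₀ (hε n).ne', one_smul, sub_add_cancel]

/-- A maximiser of `⟨·, y⟩` over a set that is invariant under small elements does not increase
to first order. -/
lemma inner_tangent_le {C : Set V} {p y : V} (hmax : ∀ q ∈ C, inner ℝ q y ≤ inner ℝ p y)
    {g : ℕ → V →L[ℝ] V} {ε : ℕ → ℝ} {A : V →L[ℝ] V} (hε : ∀ n, 0 < ε n)
    (hA : Tendsto (fun n => (ε n)⁻¹ • (g n - 1)) atTop (𝓝 A))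
    (hC : ∀ᶠ n in atTop, g n p ∈ C) : inner ℝ (A p) y ≤ 0 := by
  have hlim : Tendsto (fun n => inner ℝ (((ε n)⁻¹ • (g n - 1)) p) y) atTop
      (𝓝 (inner ℝ (A p) y)) := by
    have hc : Continuous fun B : V →L[ℝ] V => inner ℝ (B p) y := by fun_prop
    exact (hc.tendsto A).comp hA
  refine le_of_tendsto hlim (hC.mono fun n hn => ?_)
  have := hmax _ hn
  simp only [smul_apply, sub_apply,
    one_apply_eq_self, inner_smul_left, inner_sub_left]
  exact mul_nonpos_of_nonneg_of_nonpos (by simpa using (hε n).le) (by linarith)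

variable [CompleteSpace V]

/-- The linear isometries that map `S` onto itself. -/
def isometryStabilizer (S : Set V) : Set (V →L[ℝ] V) :=
  {g | g ∈ unitary (V →L[ℝ] V) ∧ MapsTo g S S ∧ MapsTo (star g : V →L[ℝ] V) S S}

lemma one_mem_isometryStabilizer (S : Set V) : 1 ∈ isometryStabilizer S :=
  ⟨one_mem _, fun x hx => hx, by rw [star_one]; exact fun x hx => hx⟩

lemma star_mem_isometryStabilizer {S : Set V} {g : V →L[ℝ] V}
    (hg : g ∈ isometryStabilizer S) : star g ∈ isometryStabilizer S :=
  ⟨Unitary.star_mem hg.1, hg.2.2, by rw [star_star]; exact hg.2.1⟩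

lemma mul_mem_isometryStabilizer {S : Set V} {g h : V →L[ℝ] V}
    (hg : g ∈ isometryStabilizer S) (hh : h ∈ isometryStabilizer S) :
    g * h ∈ isometryStabilizer S :=
  ⟨mul_mem hg.1 hh.1, hg.2.1.comp hh.2.1, by rw [star_mul]; exact hh.2.2.comp hg.2.2⟩

lemma star_apply_apply {g : V →L[ℝ] V} (hg : g ∈ unitary (V →L[ℝ] V)) (x : V) :
    star g (g x) = x := by
  rw [← mul_apply_eq_comp, Unitary.star_mul_self_of_mem hg]; rfl

lemma apply_star_apply {g : V →L[ℝ] V} (hg : g ∈ unitary (V →L[ℝ] V)) (x : V) :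
    g (star g x) = x := by
  rw [← mul_apply_eq_comp, Unitary.mul_star_self_of_mem hg]; rfl

lemma inner_star_apply (g : V →L[ℝ] V) (x y : V) :
    inner ℝ (star g x) y = inner ℝ x (g y) :=
  ContinuousLinearMap.adjoint_inner_left g y x

lemma norm_apply_of_mem_unitary {g : V →L[ℝ] V} (hg : g ∈ unitary (V →L[ℝ] V)) (x : V) :
    ‖g x‖ = ‖x‖ := by
  have h : inner ℝ (g x) (g x) = inner ℝ x x := by
    rw [← inner_star_apply, star_apply_apply hg]
  rw [real_inner_self_eq_norm_sq, real_inner_self_eq_norm_sq] at h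
  exact (sq_eq_sq₀ (norm_nonneg _) (norm_nonneg _)).1 h

lemma isCompact_isometryStabilizer [FiniteDimensional ℝ V] {S : Set V} (hS : IsClosed S) :
    IsCompact (isometryStabilizer S) := by
  refine Metric.isCompact_of_isClosed_isBounded ?_ ?_
  · have h1 : IsClosed {g : V →L[ℝ] V | g ∈ unitary (V →L[ℝ] V)} := by
      simp only [Unitary.mem_iff, ofPred_and]
      exact (isClosed_eq (by fun_prop) (by fun_prop)).inter
        (isClosed_eq (by fun_prop) (by fun_prop))
    have h2 : IsClosed {g : V →L[ℝ] V | MapsTo g S S} := by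
      simp only [MapsTo, ofPred_forall]
      exact isClosed_iInter fun x => isClosed_iInter fun _ => hS.preimage (by fun_prop)
    exact h1.inter (h2.inter (h2.preimage continuous_star))
  · refine (Metric.isBounded_closedBall (x := (0 : V →L[ℝ] V)) (r := 1)).subset fun g hg => ?_
    rw [mem_closedBall_zero_iff]
    exact g.opNorm_le_bound zero_le_one fun x => by
      rw [norm_apply_of_mem_unitary hg.1, one_mul]

lemma apply_mem_extremePoints {S : Set V} {g : V →L[ℝ] V}
    (hg : g ∈ isometryStabilizer S) {x : V} (hx : x ∈ extremePoints ℝ S) :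
    g x ∈ extremePoints ℝ S := by
  refine ⟨hg.2.1 hx.1, fun a ha b hb hab => ?_⟩
  obtain ⟨s, t, hs, ht, hst, hab⟩ := hab
  have := hx.2 (hg.2.2 ha) (hg.2.2 hb) ⟨s, t, hs, ht, hst, by
    rw [← map_smul, ← map_smul, ← map_add, hab, star_apply_apply hg.1]⟩
  rw [← this, apply_star_apply hg.1]

/-- The isometries of `S` act transitively on its extreme points. -/
def IsometryTransitive (S : Set V) : Prop :=
  ∀ x ∈ extremePoints ℝ S, ∀ y ∈ extremePoints ℝ S, ∃ g ∈ isometryStabilizer S, g x = y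

lemma IsometryTransitive.extremePoints_eq {S : Set V} (h : IsometryTransitive S) {x : V}
    (hx : x ∈ extremePoints ℝ S) :
    extremePoints ℝ S = (fun g : V →L[ℝ] V => g x) '' isometryStabilizer S := by
  ext y
  constructor
  · exact fun hy => h x hx y hy
  · rintro ⟨g, hg, rfl⟩
    exact apply_mem_extremePoints hg hx

lemma IsometryTransitive.isCompact_extremePoints [FiniteDimensional ℝ V] {S : Set V}
    (h : IsometryTransitive S)
    (hS : IsClosed S) : IsCompact (extremePoints ℝ S) := by
  rcases (extremePoints ℝ S).eq_empty_or_nonempty with he | ⟨x, hx⟩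
  · rw [he]; exact isCompact_empty
  · rw [h.extremePoints_eq hx]
    exact (isCompact_isometryStabilizer hS).image (by fun_prop)

/-- `A` is a limit of rescaled displacements `(g - 1) / ε` with `g ∈ K` and `ε → 0`. -/
def IsTangent (K : Set (V →L[ℝ] V)) (A : V →L[ℝ] V) : Prop :=
  ∃ (g : ℕ → V →L[ℝ] V) (ε : ℕ → ℝ), (∀ n, g n ∈ K) ∧ (∀ n, 0 < ε n) ∧
    Tendsto ε atTop (𝓝 0) ∧ Tendsto (fun n => (ε n)⁻¹ • (g n - 1)) atTop (𝓝 A)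

lemma exists_isTangent_of_infinite [FiniteDimensional ℝ V] {S : Set V} (hS : IsClosed S)
    (hinf : (isometryStabilizer S).Infinite) :
    ∃ A, A ≠ 0 ∧ IsTangent (isometryStabilizer S) A := by
  obtain ⟨a, ha, hacc⟩ :=
    hinf.exists_accPt_of_subset_isCompact (isCompact_isometryStabilizer hS) Subset.rfl
  have hfreq := accPt_iff_frequently.1 hacc
  obtain ⟨f, hf, hfK⟩ := exists_seq_forall_of_frequently hfreq
  set g : ℕ → V →L[ℝ] V := fun n => star a * f n with hg
  have hgK : ∀ n, g n ∈ isometryStabilizer S := fun n =>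
    mul_mem_isometryStabilizer (star_mem_isometryStabilizer ha) (hfK n).2
  have hg1 : Tendsto g atTop (𝓝 1) := by
    rw [← Unitary.star_mul_self_of_mem ha.1]
    exact hf.const_mul _
  have hgne : ∀ n, g n - 1 ≠ 0 := fun n h => (hfK n).1 <| by
    have h2 : a * (star a * f n) = a * 1 := by rw [show star a * f n = 1 from sub_eq_zero.1 h]
    rwa [← mul_assoc, Unitary.mul_star_self_of_mem ha.1, one_mul, mul_one] at h2
  have hε : Tendsto (fun n => ‖g n - 1‖) atTop (𝓝 0) := by
    have := (hg1.sub_const 1).norm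
    simpa using this
  have hmem : ∀ n, ‖g n - 1‖⁻¹ • (g n - 1) ∈ Metric.sphere (0 : V →L[ℝ] V) 1 := fun n => by
    rw [mem_sphere_zero_iff_norm, norm_smul, norm_inv, norm_norm,
      inv_mul_cancel₀ (norm_ne_zero_iff.2 (hgne n))]
  obtain ⟨A, hA, φ, hφ, hlim⟩ := (isCompact_sphere (0 : V →L[ℝ] V) 1).tendsto_subseq hmem
  refine ⟨A, ?_, g ∘ φ, fun n => ‖g (φ n) - 1‖, fun n => hgK _,
    fun n => norm_pos_iff.2 (hgne _), hε.comp hφ.tendsto_atTop, hlim⟩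
  rintro rfl
  simp at hA

lemma IsTangent.star_eq_neg {S : Set V} {A : V →L[ℝ] V}
    (h : IsTangent (isometryStabilizer S) A) : star A = -A := by
  obtain ⟨g, ε, hg, hε, h0, hA⟩ := h
  have h1 := tendsto_one_of_tendsto_rescaled hε h0 hA
  have h2 : Tendsto (fun n => star ((ε n)⁻¹ • (g n - 1)) * g n) atTop (𝓝 (star A * 1)) :=
    (hA.star).mul h1
  have h3 : Tendsto (fun n => star ((ε n)⁻¹ • (g n - 1)) * g n) atTop (𝓝 (-A)) := by
    refine hA.neg.congr fun n => ?_
    rw [star_smul, star_sub, star_one, smul_mul_assoc, sub_mul, one_mul,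
      Unitary.star_mul_self_of_mem (hg n).1, ← smul_neg, neg_sub]
    simp
  simpa using tendsto_nhds_unique h2 h3

lemma IsTangent.star {S : Set V} {A : V →L[ℝ] V}
    (h : IsTangent (isometryStabilizer S) A) : IsTangent (isometryStabilizer S) (star A) := by
  obtain ⟨g, ε, hg, hε, h0, hA⟩ := h
  refine ⟨fun n => Star.star (g n), ε, fun n => star_mem_isometryStabilizer (hg n), hε, h0, ?_⟩
  refine hA.star.congr fun n => ?_
  rw [star_smul, star_sub, star_one]
  simp

lemma IsTangent.conj {S : Set V} {A : V →L[ℝ] V}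
    (h : IsTangent (isometryStabilizer S) A) {k : V →L[ℝ] V}
    (hk : k ∈ isometryStabilizer S) :
    IsTangent (isometryStabilizer S) (k * A * Star.star k) := by
  obtain ⟨g, ε, hg, hε, h0, hA⟩ := h
  refine ⟨fun n => k * g n * Star.star k, ε, fun n => mul_mem_isometryStabilizer
    (mul_mem_isometryStabilizer hk (hg n)) (star_mem_isometryStabilizer hk), hε, h0, ?_⟩
  refine ((hA.const_mul k).mul_const _).congr fun n => ?_
  rw [mul_smul_comm, smul_mul_assoc, mul_sub, sub_mul, mul_one,
    Unitary.mul_star_self_of_mem hk.1]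

lemma IsTangent.inner_eq_zero {S C : Set V} {p y : V}
    (hmax : ∀ q ∈ C, inner ℝ q y ≤ inner ℝ p y)
    (hC : ∀ g ∈ isometryStabilizer S, g p ∈ C) {A : V →L[ℝ] V}
    (hA : IsTangent (isometryStabilizer S) A) : inner ℝ (A p) y = 0 := by
  have key : ∀ B : V →L[ℝ] V, IsTangent (isometryStabilizer S) B → inner ℝ (B p) y ≤ 0 := by
    rintro B ⟨g, ε, hg, hε, -, hB⟩
    exact inner_tangent_le hmax hε hB (Eventually.of_forall fun n => hC _ (hg n))
  refine le_antisymm (key A hA) ?_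
  have := key _ hA.star
  rw [hA.star_eq_neg, neg_apply, inner_neg_left] at this
  linarith

lemma IsTangent.inner_commutator_eq_zero {S : Set V} {A B : V →L[ℝ] V} {p y : V}
    (hA : IsTangent (isometryStabilizer S) A)
    (hB : ∀ k ∈ isometryStabilizer S, inner ℝ ((k * B * Star.star k) p) y = 0) :
    inner ℝ ((A * B - B * A) p) y = 0 := by
  have hstar := hA.star_eq_neg
  obtain ⟨g, ε, hg, hε, h0, hA⟩ := hA
  have h1 := tendsto_one_of_tendsto_rescaled hε h0 hA
  have hlim : Tendsto (fun n => ((ε n)⁻¹ • (g n - 1)) * B * Star.star (g n)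
      + B * Star.star ((ε n)⁻¹ • (g n - 1))) atTop (𝓝 (A * B * Star.star 1 + B * Star.star A)) :=
    ((hA.mul_const B).mul h1.star).add (hA.star.const_mul B)
  have heq : A * B * Star.star 1 + B * Star.star A = A * B - B * A := by
    rw [hstar, star_one]; noncomm_ring
  rw [heq] at hlim
  have hc : Continuous fun D : V →L[ℝ] V => inner ℝ (D p) y := by fun_prop
  refine tendsto_nhds_unique ((hc.tendsto _).comp hlim) (tendsto_const_nhds.congr fun n => ?_)
  have h2 : ((ε n)⁻¹ • (g n - 1)) * B * Star.star (g n) + B * Star.star ((ε n)⁻¹ • (g n - 1))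
      = (ε n)⁻¹ • (g n * B * Star.star (g n) - 1 * B * Star.star 1) := by
    rw [star_smul, star_sub, star_one, star_trivial ((ε n)⁻¹), smul_mul_assoc, smul_mul_assoc,
      mul_smul_comm, ← smul_add]
    congr 1
    noncomm_ring
  have h3 := hB 1 (one_mem_isometryStabilizer S)
  simp only [Function.comp, h2, smul_apply, sub_apply, inner_smul_left, inner_sub_left,
    hB _ (hg n), h3, sub_zero, mul_zero]

end IsometryGroup

/-- Euclidean three-space. -/
local notation "V3" => EuclideanSpace ℝ (Fin 3)

/-- The cross product on Euclidean three-space. -/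
def cross (x y : V3) : V3 :=
  !₂[x 1 * y 2 - x 2 * y 1, x 2 * y 0 - x 0 * y 2, x 0 * y 1 - x 1 * y 0]

lemma inner_eq_sum (x y : V3) : inner ℝ x y = x 0 * y 0 + x 1 * y 1 + x 2 * y 2 := by
  simp [PiLp.inner_apply, Fin.sum_univ_three, mul_comm]

lemma norm_sq_eq_sum (x : V3) : ‖x‖ ^ 2 = x 0 ^ 2 + x 1 ^ 2 + x 2 ^ 2 := by
  rw [← real_inner_self_eq_norm_sq, inner_eq_sum]; ring

lemma eq_zero_iff_coord (x : V3) : x = 0 ↔ x 0 = 0 ∧ x 1 = 0 ∧ x 2 = 0 := by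
  constructor
  · rintro rfl; simp
  · rintro ⟨h0, h1, h2⟩
    ext i; fin_cases i <;> simpa

lemma inner_cross (w p y : V3) : inner ℝ (cross w p) y = inner ℝ w (cross p y) := by
  simp only [inner_eq_sum, cross]
  simp
  ring

lemma norm_cross_sq (x y : V3) :
    ‖cross x y‖ ^ 2 = ‖x‖ ^ 2 * ‖y‖ ^ 2 - (inner ℝ x y) ^ 2 := by
  simp only [inner_eq_sum, norm_sq_eq_sum, cross]
  simp
  ring

lemma cross_cross_sub (v w x : V3) :
    cross v (cross w x) - cross w (cross v x) = cross (cross v w) x := by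
  ext i
  fin_cases i <;> simp [cross] <;> ring

lemma cross_cross_smul (v w n : V3) :
    ‖cross v w‖ ^ 2 • n = inner ℝ v n • cross w (cross v w) + inner ℝ w n • cross (cross v w) v
      + inner ℝ (cross v w) n • cross v w := by
  ext i
  fin_cases i <;> simp [cross, norm_sq_eq_sum, inner_eq_sum] <;> ring

lemma eq_or_eq_neg_of_cross_eq_zero {x y : V3} (h : cross x y = 0) (hn : ‖x‖ = ‖y‖) :
    x = y ∨ x = -y := by
  have h1 := norm_cross_sq x y
  rw [h, norm_zero, hn] at h1
  have h2 : (‖y‖ ^ 2 - inner ℝ x y) * (‖y‖ ^ 2 + inner ℝ x y) = 0 := by linarith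
  rcases mul_eq_zero.1 h2 with h3 | h3
  · left
    have : ‖x - y‖ ^ 2 = 0 := by rw [norm_sub_sq_real, hn]; linarith
    exact sub_eq_zero.1 (norm_eq_zero.1 (pow_eq_zero_iff two_ne_zero |>.1 this))
  · right
    have : ‖x + y‖ ^ 2 = 0 := by rw [norm_add_sq_real, hn]; linarith
    exact add_eq_zero_iff_eq_neg.1 (norm_eq_zero.1 (pow_eq_zero_iff two_ne_zero |>.1 this))

lemma cross_eq_zero_trans {v w x : V3} (hw : w ≠ 0) (hvw : cross v w = 0) (hwx : cross w x = 0) :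
    cross v x = 0 := by
  have key : ‖w‖ ^ 2 • cross v x
      = inner ℝ w x • cross v w + inner ℝ v w • cross w x - inner ℝ w (cross v x) • w
        + (2 * inner ℝ w (cross v x)) • w := by
    ext i
    fin_cases i <;> simp [cross, norm_sq_eq_sum, inner_eq_sum] <;> ring
  have h0 : inner ℝ w (cross v x) = 0 := by
    have : inner ℝ w (cross v x) = - inner ℝ v (cross w x) := by
      simp only [inner_eq_sum, cross]
      simp
      ring
    rw [this, hwx, inner_zero_right, neg_zero]
  rw [hvw, hwx, h0] at key
  simpa [hw] using key

lemma exists_eq_cross_of_star_eq_neg {A : V3 →L[ℝ] V3} (hA : star A = -A) :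
    ∃ w : V3, ∀ x, A x = cross w x := by
  set e : Fin 3 → V3 := fun i => EuclideanSpace.single i (1 : ℝ) with he
  have hskew : ∀ i j, A (e i) j = - A (e j) i := fun i j => by
    have h := ContinuousLinearMap.adjoint_inner_left A (e j) (e i)
    rw [← ContinuousLinearMap.star_eq_adjoint, hA] at h
    simp only [he, neg_apply, inner_neg_left, EuclideanSpace.inner_single_left,
      EuclideanSpace.inner_single_right] at h
    simp at h
    simp only [he]
    linarith
  refine ⟨!₂[A (e 1) 2, A (e 2) 0, A (e 0) 1], fun x => ?_⟩
  have hx : x = x 0 • e 0 + x 1 • e 1 + x 2 • e 2 := by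
    ext i; fin_cases i <;> simp [he]
  have hd : ∀ i, A (e i) i = 0 := fun i => by linarith [hskew i i]
  have h10 := hskew 1 0
  have h20 := hskew 0 2
  have h21 := hskew 2 1
  conv_lhs => rw [hx]
  ext i
  fin_cases i <;> simp [cross, hd, h10, h20, h21] <;> ring

lemma exists_extremePoint_inner_ne {S : Set V3} (hc : IsCompact S) (hconv : Convex ℝ S)
    (hspan : affineSpan ℝ S = ⊤) {w : V3} (hw : w ≠ 0) (h : ℝ) :
    ∃ p ∈ extremePoints ℝ S, inner ℝ p w ≠ h := by
  by_contra! hX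
  have hcl : IsClosed {p : V3 | inner ℝ p w = h} := isClosed_eq (by fun_prop) continuous_const
  have hcv : Convex ℝ {p : V3 | inner ℝ p w = h} := by
    intro x hx y hy a b _ _ hab
    simp only [mem_ofPred_eq] at hx hy ⊢
    rw [inner_add_left, real_inner_smul_left, real_inner_smul_left, hx, hy, ← add_mul, hab,
      one_mul]
  have hS : S ⊆ {p : V3 | inner ℝ p w = h} := by
    rw [← closure_convexHull_extremePoints hc hconv]
    exact hcl.closure_subset_iff.2 (convexHull_min hX hcv)
  obtain ⟨x, hx⟩ := (hconv.interior_nonempty_iff_affineSpan_eq_top).2 hspan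
  have hint := interior_mono hS hx
  rw [interior_hyperplane_eq_empty hw] at hint
  exact hint

lemma IsometryTransitive.norm_eq {S : Set V3} (h : IsometryTransitive S) {x y : V3}
    (hx : x ∈ extremePoints ℝ S) (hy : y ∈ extremePoints ℝ S) : ‖y‖ = ‖x‖ := by
  obtain ⟨g, hg, rfl⟩ := h x hx y hy
  exact norm_apply_of_mem_unitary hg.1 x

lemma inner_le_neg_sq_iff {q y : V3} (hn : ‖q‖ = ‖y‖) (h : inner ℝ q y ≤ -‖y‖ ^ 2) :
    q = -y := by
  have : ‖q + y‖ ^ 2 ≤ 0 := by rw [norm_add_sq_real, hn]; linarith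
  exact add_eq_zero_iff_eq_neg.1
    (norm_eq_zero.1 (pow_eq_zero_iff two_ne_zero |>.1 (le_antisymm this (sq_nonneg _))))

/-- If the tangent axes of the symmetry group are not all parallel, the extreme points fill the
sphere. -/
lemma IsometryTransitive.sphere_subset {S : Set V3} (h : IsometryTransitive S)
    (hS : IsClosed S) (hinf : (extremePoints ℝ S).Infinite) {x : V3}
    (hx : x ∈ extremePoints ℝ S) {A B : V3 →L[ℝ] V3} {v w : V3}
    (hA : IsTangent (isometryStabilizer S) A) (hB : IsTangent (isometryStabilizer S) B)
    (hAv : ∀ x, A x = cross v x) (hBw : ∀ x, B x = cross w x) (hvw : cross v w ≠ 0) {y : V3}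
    (hy : ‖y‖ = ‖x‖) : y ∈ extremePoints ℝ S := by
  obtain ⟨p, hp, hmax⟩ := (h.isCompact_extremePoints hS).exists_isMaxOn ⟨x, hx⟩
    (f := fun q => inner ℝ q y) (by fun_prop)
  have hpy : ‖p‖ = ‖y‖ := by rw [hy, h.norm_eq hx hp]
  have hzero : ∀ D : V3 →L[ℝ] V3, IsTangent (isometryStabilizer S) D → inner ℝ (D p) y = 0 :=
    fun D hD => hD.inner_eq_zero hmax fun g hg => apply_mem_extremePoints hg hp
  have h1 := hzero A hA
  have h2 := hzero B hB
  have h3 := hA.inner_commutator_eq_zero fun k hk => hzero _ (hB.conj hk)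
  rw [hAv, inner_cross] at h1
  rw [hBw, inner_cross] at h2
  rw [sub_apply, mul_apply_eq_comp, mul_apply_eq_comp, hAv, hBw, hBw, hAv, cross_cross_sub,
    inner_cross] at h3
  have h4 := cross_cross_smul v w (cross p y)
  rw [h1, h2, h3] at h4
  have h5 : cross p y = 0 := by simpa [hvw] using h4
  rcases eq_or_eq_neg_of_cross_eq_zero h5 hpy with rfl | rfl
  · exact hp
  · refine absurd ((finite_singleton (-y)).subset fun q hq => ?_) hinf
    refine inner_le_neg_sq_iff (by rw [hy, h.norm_eq hx hq]) ?_
    have := hmax hq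
    simpa [inner_neg_left, real_inner_self_eq_norm_sq] using this

/-- The component of `q` orthogonal to `w`, scaled by `‖w‖ ^ 2`. -/
def axisPerp (w q : V3) : V3 := ‖w‖ ^ 2 • q - inner ℝ q w • w

lemma inner_axisPerp (w p q : V3) : inner ℝ (axisPerp w p) (axisPerp w q)
    = ‖w‖ ^ 2 * (‖w‖ ^ 2 * inner ℝ p q - inner ℝ p w * inner ℝ q w) := by
  simp only [axisPerp, inner_sub_left, inner_sub_right, real_inner_smul_left,
    real_inner_smul_right, real_inner_self_eq_norm_sq, real_inner_comm q w]
  ring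

lemma cross_axisPerp (w p q : V3) :
    cross (axisPerp w p) (axisPerp w q) = (‖w‖ ^ 2 * inner ℝ w (cross p q)) • w := by
  ext i
  fin_cases i <;> simp [axisPerp, cross, norm_sq_eq_sum, inner_eq_sum] <;> ring

/-- If every symmetry preserves the tangent axis `w`, each extreme point comes with its whole
circle around that axis. -/
lemma IsometryTransitive.circle_subset {S : Set V3} (h : IsometryTransitive S)
    (hS : IsClosed S) {x : V3} (hx : x ∈ extremePoints ℝ S) {A : V3 →L[ℝ] V3} {w : V3}
    (hw : w ≠ 0) (hA : IsTangent (isometryStabilizer S) A) (hAw : ∀ x, A x = cross w x)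
    (hpres : ∀ g ∈ isometryStabilizer S, g w = w ∨ g w = -w) {y : V3}
    (hy : ‖y‖ = ‖x‖) (hyw : inner ℝ y w = inner ℝ x w) : y ∈ extremePoints ℝ S := by
  set C : Set V3 := extremePoints ℝ S ∩ {q | inner ℝ q w = inner ℝ x w} with hC
  have hCc : IsCompact C := (h.isCompact_extremePoints hS).inter_right
    (isClosed_eq (by fun_prop) continuous_const)
  obtain ⟨p, hp, hmax⟩ := hCc.exists_isMaxOn ⟨x, hx, rfl⟩
    (f := fun q => inner ℝ q y) (by fun_prop)
  have hpy : ‖p‖ = ‖y‖ := by rw [hy, h.norm_eq hx hp.1]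
  have hpw : inner ℝ p w = inner ℝ y w := by rw [hyw, hp.2]
  have hCinv : ∀ B, IsTangent (isometryStabilizer S) B → ∃ (g : ℕ → V3 →L[ℝ] V3) (ε : ℕ → ℝ),
      (∀ n, 0 < ε n) ∧ Tendsto (fun n => (ε n)⁻¹ • (g n - 1)) atTop (𝓝 B) ∧
      ∀ᶠ n in atTop, g n p ∈ C := by
    rintro B ⟨g, ε, hg, hε, h0, hB⟩
    refine ⟨g, ε, hε, hB, ?_⟩
    have h1 : Tendsto (fun n => g n w) atTop (𝓝 w) := by
      have hc : Continuous fun D : V3 →L[ℝ] V3 => D w := by fun_prop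
      exact (hc.tendsto 1).comp (tendsto_one_of_tendsto_rescaled hε h0 hB)
    have h2 : ∀ᶠ n in atTop, g n w ≠ -w := h1.eventually_ne fun h => hw (by
      have h3 : (2 : ℝ) • w = 0 := by rw [two_smul]; exact add_eq_zero_iff_eq_neg.2 h
      simpa using h3)
    refine h2.mono fun n hn => ⟨apply_mem_extremePoints (hg n) hp.1, ?_⟩
    have h3 : g n w = w := (hpres _ (hg n)).resolve_right hn
    have h4 : star (g n) w = w := by
      conv_lhs => rw [← h3]
      exact star_apply_apply (hg n).1 w
    have h5 := inner_star_apply (star (g n)) p w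
    rw [star_star, h4] at h5
    exact h5.trans hp.2
  have h1 : inner ℝ (A p) y = 0 := by
    refine le_antisymm ?_ ?_
    · obtain ⟨g, ε, hε, hB, hev⟩ := hCinv A hA
      exact inner_tangent_le hmax hε hB hev
    · obtain ⟨g, ε, hε, hB, hev⟩ := hCinv _ hA.star
      have := inner_tangent_le hmax hε hB hev
      rw [hA.star_eq_neg, neg_apply, inner_neg_left] at this
      linarith
  rw [hAw, inner_cross] at h1
  have hnorm : ‖axisPerp w p‖ = ‖axisPerp w y‖ := by
    rw [← sq_eq_sq₀ (norm_nonneg _) (norm_nonneg _), ← real_inner_self_eq_norm_sq,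
      ← real_inner_self_eq_norm_sq, inner_axisPerp, inner_axisPerp, real_inner_self_eq_norm_sq,
      real_inner_self_eq_norm_sq, hpy, hpw]
  have hcross : cross (axisPerp w p) (axisPerp w y) = 0 := by
    rw [cross_axisPerp, h1, mul_zero, zero_smul]
  have hinj : ∀ q, inner ℝ q w = inner ℝ y w → axisPerp w q = axisPerp w y → q = y := by
    intro q hqw hq
    simp only [axisPerp, hqw] at hq
    exact smul_right_injective _ (pow_ne_zero 2 (norm_ne_zero_iff.2 hw)) (sub_left_injective hq)
  rcases eq_or_eq_neg_of_cross_eq_zero hcross hnorm with heq | heq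
  · rw [← hinj p hpw heq]; exact hp.1
  · have hsingle : ∀ q ∈ C, q = p := by
      intro q hq
      have hqp : inner ℝ q w = inner ℝ p w := hq.2.trans hp.2.symm
      have h2 : axisPerp w q = -axisPerp w y := by
        refine inner_le_neg_sq_iff ?_ ?_
        · rw [← sq_eq_sq₀ (norm_nonneg _) (norm_nonneg _), ← real_inner_self_eq_norm_sq,
            ← real_inner_self_eq_norm_sq, inner_axisPerp, inner_axisPerp,
            real_inner_self_eq_norm_sq, real_inner_self_eq_norm_sq, h.norm_eq hx hq.1, hy, hqp,
            hpw]
        · have h3 : inner ℝ (axisPerp w p) (axisPerp w y) = -‖axisPerp w y‖ ^ 2 := by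
            rw [heq, inner_neg_left, real_inner_self_eq_norm_sq]
          rw [← h3, inner_axisPerp, inner_axisPerp, hqp]
          have := hmax hq
          simp only [mem_ofPred_eq] at this
          gcongr
      have h3 := h2.trans heq.symm
      simp only [axisPerp, hqp] at h3
      exact smul_right_injective _ (pow_ne_zero 2 (norm_ne_zero_iff.2 hw)) (sub_left_injective h3)
    have hAp : A p = 0 := by
      obtain ⟨g, ε, hε, hB, hev⟩ := hCinv A hA
      have hc : Continuous fun D : V3 →L[ℝ] V3 => D p := by fun_prop
      refine tendsto_nhds_unique ((hc.tendsto _).comp hB)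
        (tendsto_const_nhds.congr' (hev.mono fun n hn => ?_))
      simp [hsingle _ hn]
    have h2 : axisPerp w p = 0 := by
      have h3 := norm_cross_sq w p
      rw [← hAw, hAp, norm_zero] at h3
      have h4 : ‖axisPerp w p‖ ^ 2 = 0 := by
        rw [← real_inner_self_eq_norm_sq, inner_axisPerp, real_inner_self_eq_norm_sq]
        rw [real_inner_comm] at h3
        linear_combination (-‖w‖ ^ 2) * h3
      simpa using h4
    rw [← hinj p hpw (by rw [h2] at heq ⊢; rw [eq_comm, neg_eq_zero] at heq; exact heq.symm)]
    exact hp.1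

/-- An infinite set of extreme points permuted transitively by isometries is a sphere or a pair of
parallel circles. -/
theorem IsometryTransitive.sphere_or_circles {S : Set V3} (h : IsometryTransitive S)
    (hc : IsCompact S) (hconv : Convex ℝ S) (hspan : affineSpan ℝ S = ⊤)
    (hinf : (extremePoints ℝ S).Infinite) :
    (∃ r > 0, extremePoints ℝ S = Metric.sphere 0 r) ∨
    ∃ (u : V3) (r h : ℝ), ‖u‖ = 1 ∧ 0 < h ∧ h < r ∧
      extremePoints ℝ S = {p | ‖p‖ = r ∧ (inner ℝ p u = h ∨ inner ℝ p u = -h)} := by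
  obtain ⟨x, hx⟩ := hinf.nonempty
  have hSc := hc.isClosed
  have hKinf : (isometryStabilizer S).Infinite := fun hfin =>
    hinf (by rw [h.extremePoints_eq hx]; exact hfin.image _)
  have hxr : 0 < ‖x‖ := by
    rw [norm_pos_iff]
    rintro rfl
    refine hinf ((finite_singleton 0).subset fun q hq => ?_)
    have := h.norm_eq hx hq
    simpa using this
  obtain ⟨A, hA0, hA⟩ := exists_isTangent_of_infinite hSc hKinf
  obtain ⟨w, hAw⟩ := exists_eq_cross_of_star_eq_neg hA.star_eq_neg
  have hw : w ≠ 0 := by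
    rintro rfl
    exact hA0 (by ext1 x; rw [hAw]; ext i; fin_cases i <;> simp [cross])
  by_cases hcase : ∃ k ∈ isometryStabilizer S, cross w (k w) ≠ 0
  · left
    obtain ⟨k, hk, hkw⟩ := hcase
    have hB := hA.conj hk
    obtain ⟨v, hBv⟩ := exists_eq_cross_of_star_eq_neg hB.star_eq_neg
    refine ⟨‖x‖, hxr, Subset.antisymm (fun q hq => ?_) fun y hy => ?_⟩
    · simpa using h.norm_eq hx hq
    · refine h.sphere_subset hSc hinf hx hA hB hAw hBv (fun hwv => hkw ?_) (by simpa using hy)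
      refine cross_eq_zero_trans ?_ hwv ?_
      · rintro rfl
        refine hA0 ?_
        ext1 z
        have h1 := hBv (k z)
        rw [mul_apply_eq_comp, mul_apply_eq_comp, star_apply_apply hk.1] at h1
        have h2 : k (A z) = 0 := by
          rw [h1]; ext i; fin_cases i <;> simp [cross]
        rw [← star_apply_apply hk.1 (A z), h2, map_zero]; rfl
      · rw [← hBv, mul_apply_eq_comp, mul_apply_eq_comp, star_apply_apply hk.1, hAw]
        have : cross w w = 0 := by ext i; fin_cases i <;> simp [cross, mul_comm]
        rw [this, map_zero]
  · right
    push Not at hcase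
    have hpres : ∀ g ∈ isometryStabilizer S, g w = w ∨ g w = -w := by
      intro g hg
      rcases eq_or_eq_neg_of_cross_eq_zero (hcase g hg)
        (norm_apply_of_mem_unitary hg.1 w).symm with h1 | h1
      · exact Or.inl h1.symm
      · exact Or.inr (by rw [h1, neg_neg, ← h1])
    have hwpos : 0 < ‖w‖ := norm_pos_iff.2 hw
    have hheight : ∀ q ∈ extremePoints ℝ S, inner ℝ q w = inner ℝ x w ∨
        inner ℝ q w = -inner ℝ x w := by
      intro q hq
      obtain ⟨g, hg, rfl⟩ := h q hq x hx
      have h1 : inner ℝ (g q) (g w) = inner ℝ q w := by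
        rw [← inner_star_apply, star_apply_apply hg.1]
      rcases hpres g hg with h2 | h2 <;> rw [h2] at h1
      · exact Or.inl h1.symm
      · right; rw [← h1, inner_neg_right]
    set a : ℝ := inner ℝ x w with ha
    have ha0 : a ≠ 0 := by
      intro ha0
      obtain ⟨p, hp, hpw⟩ := exists_extremePoint_inner_ne hc hconv hspan hw 0
      rcases hheight p hp with h1 | h1 <;> simp [h1, ha0] at hpw
    obtain ⟨z, hz, hzw⟩ := exists_extremePoint_inner_ne hc hconv hspan hw a
    have hza : inner ℝ z w = -a := (hheight z hz).resolve_left hzw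
    have hlt : |a| < ‖w‖ * ‖x‖ := by
      refine lt_of_le_of_ne (by rw [ha, mul_comm]; exact abs_real_inner_le_norm x w) fun heq => ?_
      refine hinf (((finite_singleton ((‖w‖⁻¹ * ‖x‖) • w)).insert
        (-((‖w‖⁻¹ * ‖x‖) • w))).subset fun q hq => ?_)
      have hn := h.norm_eq hx hq
      have hsq : (inner ℝ q w) ^ 2 = (‖w‖ * ‖x‖) ^ 2 := by
        rw [← heq, sq_abs]
        rcases hheight q hq with h1 | h1 <;> rw [h1]
        ring
      have h2 : cross q ((‖w‖⁻¹ * ‖x‖) • w) = 0 := by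
        have h3 := norm_cross_sq q ((‖w‖⁻¹ * ‖x‖) • w)
        rw [real_inner_smul_right, mul_pow, hsq, norm_smul, hn] at h3
        have h4 : ‖cross q ((‖w‖⁻¹ * ‖x‖) • w)‖ ^ 2 = 0 := by
          rw [h3]
          simp only [norm_mul, norm_inv, norm_norm]
          ring
        simpa using h4
      rcases eq_or_eq_neg_of_cross_eq_zero h2 (by
        rw [norm_smul, norm_mul, norm_inv, norm_norm, norm_norm, hn]; field_simp) with h3 | h3
      · exact Or.inr h3
      · exact Or.inl h3
    have hiff : ∀ (q : V3) (t : ℝ), inner ℝ q (‖w‖⁻¹ • w) = ‖w‖⁻¹ * t ↔ inner ℝ q w = t := by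
      intro q t
      rw [real_inner_smul_right]
      exact mul_right_inj' (inv_ne_zero hwpos.ne')
    refine ⟨‖w‖⁻¹ • w, ‖x‖, ‖w‖⁻¹ * |a|, ?_, by positivity, ?_, ?_⟩
    · rw [norm_smul, norm_inv, norm_norm, inv_mul_cancel₀ hwpos.ne']
    · rw [inv_mul_lt_iff₀ hwpos]; exact hlt
    · have hX : extremePoints ℝ S = {p | ‖p‖ = ‖x‖ ∧ (inner ℝ p w = a ∨ inner ℝ p w = -a)} := by
        refine Subset.antisymm (fun q hq => ⟨h.norm_eq hx hq, hheight q hq⟩) ?_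
        rintro y ⟨hy, hya | hya⟩
        · exact h.circle_subset hSc hx hw hA hAw hpres hy hya
        · exact h.circle_subset hSc hz hw hA hAw hpres (by rw [hy, h.norm_eq hx hz])
            (by rw [hya, hza])
      rw [hX]
      ext q
      simp only [mem_ofPred_eq, ← mul_neg, hiff]
      rcases abs_choice a with h1 | h1 <;> rw [h1]
      rw [neg_neg, or_comm (a := inner ℝ q w = a)]

lemma convex_cylinder :
    Convex ℝ {p : V3 | p 0 ^ 2 + p 1 ^ 2 ≤ 1 ∧ p 2 ∈ Icc (0 : ℝ) 1} := by
  rintro x ⟨hx, hx0, hx1⟩ y ⟨hy, hy0, hy1⟩ a b ha hb hab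
  obtain rfl : b = 1 - a := by linarith
  refine ⟨?_, ?_, ?_⟩ <;> simp
  · nlinarith [mul_nonneg (mul_nonneg ha hb) (sq_nonneg (x 0 - y 0)),
      mul_nonneg (mul_nonneg ha hb) (sq_nonneg (x 1 - y 1)),
      mul_le_mul_of_nonneg_left hx ha, mul_le_mul_of_nonneg_left hy hb]
  · positivity
  · nlinarith

lemma isCompact_cylinder :
    IsCompact {p : V3 | p 0 ^ 2 + p 1 ^ 2 ≤ 1 ∧ p 2 ∈ Icc (0 : ℝ) 1} := by
  refine Metric.isCompact_of_isClosed_isBounded ?_ ?_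
  · exact (isClosed_le (f := fun p : V3 => p 0 ^ 2 + p 1 ^ 2) (by fun_prop) continuous_const).inter
      (isClosed_Icc.preimage (f := fun p : V3 => p 2) (by fun_prop))
  · refine (Metric.isBounded_closedBall (x := (0 : V3)) (r := 2)).subset ?_
    rintro p ⟨hp, hp0, hp1⟩
    rw [mem_closedBall_zero_iff, ← sq_le_sq₀ (norm_nonneg _) (by norm_num), norm_sq_eq_sum]
    nlinarith

lemma extremePoints_not_midpoint {C : Set V3} {p v : V3} (hp : p ∈ extremePoints ℝ C)
    (h1 : p + v ∈ C) (h2 : p - v ∈ C) : v = 0 := by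
  have := hp.2 h1 h2 ⟨1 / 2, 1 / 2, by norm_num, by norm_num, by norm_num, by module⟩
  simpa using this

lemma extremePoints_cylinder_subset :
    extremePoints ℝ {p : V3 | p 0 ^ 2 + p 1 ^ 2 ≤ 1 ∧ p 2 ∈ Icc (0 : ℝ) 1} ⊆
      {p | p 0 ^ 2 + p 1 ^ 2 = 1 ∧ (p 2 = 0 ∨ p 2 = 1)} := by
  intro p hp
  obtain ⟨hd, hz0, hz1⟩ := hp.1
  constructor
  · by_contra hne
    have hlt : p 0 ^ 2 + p 1 ^ 2 < 1 := lt_of_le_of_ne hd hne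
    set δ := (1 - (p 0 ^ 2 + p 1 ^ 2)) / 4 with hδ
    have hδ0 : 0 < δ := by rw [hδ]; linarith
    have habs : |p 0| ≤ 1 := by rw [abs_le]; constructor <;> nlinarith [sq_nonneg (p 1)]
    obtain ⟨h1, h2⟩ := abs_le.1 habs
    have hδ1 : δ ≤ 1 / 4 := by rw [hδ]; nlinarith [sq_nonneg (p 0), sq_nonneg (p 1)]
    have := extremePoints_not_midpoint (v := !₂[δ, 0, 0]) hp
      ⟨by simp; nlinarith, by simpa using ⟨hz0, hz1⟩⟩
      ⟨by simp; nlinarith, by simpa using ⟨hz0, hz1⟩⟩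
    have h3 := ((eq_zero_iff_coord _).1 this).1
    simp at h3
    exact hδ0.ne' h3
  · by_contra! hne
    have hlt0 : 0 < p 2 := lt_of_le_of_ne hz0 hne.1.symm
    have hlt1 : p 2 < 1 := lt_of_le_of_ne hz1 hne.2
    have hδ0 : 0 < min (p 2) (1 - p 2) := lt_min hlt0 (by linarith)
    have h1 := min_le_left (p 2) (1 - p 2)
    have h2 := min_le_right (p 2) (1 - p 2)
    have := extremePoints_not_midpoint (v := !₂[0, 0, min (p 2) (1 - p 2)]) hp
      ⟨by simpa using hd, by constructor <;> (simp; grind)⟩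
      ⟨by simpa using hd, by simp, by simp; grind⟩
    have h3 := ((eq_zero_iff_coord _).1 this).2.2
    simp only [Matrix.cons_val] at h3
    exact hδ0.ne' h3

/-- Krein-Milman comparison: an affine image of `S` equals `C` as soon as the image of the extreme
points lies in `C` and covers the extreme points of `C`. -/
lemma image_eq_of_extremePoints {S C : Set V3} (hSc : IsCompact S) (hS : Convex ℝ S)
    (hCc : IsCompact C) (hC : Convex ℝ C) {f : V3 →ᵃ[ℝ] V3}
    (h1 : f '' extremePoints ℝ S ⊆ C) (h2 : extremePoints ℝ C ⊆ f '' extremePoints ℝ S) :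
    f '' S = C := by
  have hf : Continuous f := f.continuous_of_finiteDimensional
  refine Subset.antisymm (image_subset_iff.2 ?_) ?_
  · rw [← closure_convexHull_extremePoints hSc hS]
    exact (hCc.isClosed.preimage hf).closure_subset_iff.2
      (convexHull_min (image_subset_iff.1 h1) (hC.affine_preimage f))
  · rw [← closure_convexHull_extremePoints hCc hC]
    exact (hSc.image hf).isClosed.closure_subset_iff.2
      (convexHull_min (h2.trans (image_mono extremePoints_subset)) (hS.affine_image f))

lemma affIso_closedBall_of_extremePoints_eq_sphere {S : Set V3} (hSc : IsCompact S)
    (hS : Convex ℝ S) {r : ℝ} (hr : 0 < r) (h : extremePoints ℝ S = Metric.sphere 0 r) :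
    AffIso S (Metric.closedBall (0 : V3) 1) := by
  refine ⟨(LinearMap.lsmul ℝ V3 r⁻¹).toAffineMap, ?_, ?_⟩
  · exact (smul_right_injective V3 (inv_ne_zero hr.ne')).injOn
  · refine image_eq_of_extremePoints hSc hS (isCompact_closedBall _ _)
      (convex_closedBall _ _) ?_ ?_
    · rw [h, image_subset_iff]
      intro p hp
      simp only [mem_sphere_zero_iff_norm] at hp
      simp [norm_smul, hp, abs_of_pos hr, hr.ne']
    · refine extremePoints_closedBall_subset_sphere.trans fun p hp => ?_
      rw [h]
      simp only [mem_sphere_zero_iff_norm] at hp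
      refine ⟨r • p, ?_, ?_⟩
      · simp [norm_smul, hp, abs_of_pos hr]
      · simp [smul_smul, hr.ne']

/-- The linear map scaling the first two coordinates by `a` and the third by `b`. -/
def axisScale (a b : ℝ) : V3 →ₗ[ℝ] V3 where
  toFun x := !₂[a * x 0, a * x 1, b * x 2]
  map_add' x y := by ext i; fin_cases i <;> simp <;> ring
  map_smul' c x := by ext i; fin_cases i <;> simp <;> ring

lemma affIso_cylinder_of_extremePoints_eq_circles {S : Set V3} (hSc : IsCompact S)
    (hS : Convex ℝ S) {u : V3} {r h : ℝ} (hu : ‖u‖ = 1) (hh : 0 < h) (hr : h < r)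
    (hX : extremePoints ℝ S = {p | ‖p‖ = r ∧ (inner ℝ p u = h ∨ inner ℝ p u = -h)}) :
    AffIso S {p : V3 | p 0 ^ 2 + p 1 ^ 2 ≤ 1 ∧ p 2 ∈ Icc (0 : ℝ) 1} := by
  obtain ⟨b, hb⟩ := Orthonormal.exists_orthonormalBasis_extension_of_card_eq (𝕜 := ℝ) (E := V3)
    (ι := Fin 3) (by simp) (v := fun _ => u) (s := {2})
    ⟨fun i => hu, fun i j hij => absurd (Subsingleton.elim i j) hij⟩
  have hb2 : b 2 = u := hb 2 rfl
  set ρ := √(r ^ 2 - h ^ 2) with hρ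
  have hρsq : ρ ^ 2 = r ^ 2 - h ^ 2 := Real.sq_sqrt (by nlinarith)
  have hρ0 : 0 < ρ := Real.sqrt_pos.2 (by nlinarith)
  have hcoord : ∀ p, b.repr p 2 = inner ℝ p u := fun p => by
    rw [b.repr_apply_apply, hb2, real_inner_comm]
  have hnorm : ∀ p, ‖p‖ ^ 2 = b.repr p 0 ^ 2 + b.repr p 1 ^ 2 + b.repr p 2 ^ 2 := fun p => by
    rw [← norm_sq_eq_sum, b.repr.norm_map]
  set f : V3 →ᵃ[ℝ] V3 := ((axisScale ρ⁻¹ (2 * h)⁻¹) ∘ₗ b.repr.toLinearMap).toAffineMap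
    + AffineMap.const ℝ V3 !₂[0, 0, 1 / 2] with hf
  have hf0 : ∀ p, f p 0 = ρ⁻¹ * b.repr p 0 := fun p => by simp [hf, axisScale]
  have hf1 : ∀ p, f p 1 = ρ⁻¹ * b.repr p 1 := fun p => by simp [hf, axisScale]
  have hf2 : ∀ p, f p 2 = (2 * h)⁻¹ * b.repr p 2 + 1 / 2 := fun p => by simp [hf, axisScale]
  have hiff : ∀ p, p ∈ extremePoints ℝ S ↔
      f p 0 ^ 2 + f p 1 ^ 2 = 1 ∧ (f p 2 = 0 ∨ f p 2 = 1) := by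
    intro p
    have e1 : ‖p‖ = r ↔ b.repr p 0 ^ 2 + b.repr p 1 ^ 2 + b.repr p 2 ^ 2 = r ^ 2 := by
      rw [← hnorm, sq_eq_sq₀ (norm_nonneg _) (by linarith)]
    have e2 : f p 0 ^ 2 + f p 1 ^ 2 = 1 ↔ b.repr p 0 ^ 2 + b.repr p 1 ^ 2 = r ^ 2 - h ^ 2 := by
      rw [hf0, hf1, ← hρsq, mul_pow, mul_pow, ← mul_add, inv_pow, inv_mul_eq_one₀ (by positivity),
        eq_comm]
    have e3 : f p 2 = 0 ↔ b.repr p 2 = -h := by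
      rw [hf2]; field_simp; constructor <;> intro H <;> linarith
    have e4 : f p 2 = 1 ↔ b.repr p 2 = h := by
      rw [hf2]; field_simp; constructor <;> intro H <;> linarith
    rw [hX, mem_ofPred_eq, e1, e2, e3, e4, ← hcoord]
    constructor
    · rintro ⟨H, H1 | H1⟩ <;> rw [H1] at H ⊢ <;> constructor <;> first | linarith | simp
    · rintro ⟨H, H1 | H1⟩ <;> rw [H1] <;> constructor <;> first | linarith | simp
  have hsurj : Function.Surjective f := by
    intro q
    refine ⟨b.repr.symm !₂[ρ * q 0, ρ * q 1, (2 * h) * (q 2 - 1 / 2)], ?_⟩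
    ext i
    fin_cases i
    · simp [hf0, hρ0.ne']
    · simp [hf1, hρ0.ne']
    · simp [hf2]; field_simp; ring
  have hinj : Function.Injective f := by
    intro p q hpq
    apply b.repr.injective
    have h0 := hf0 p
    have h1 := hf1 p
    have h2 := hf2 p
    rw [hpq, hf0] at h0
    rw [hpq, hf1] at h1
    rw [hpq, hf2] at h2
    have c1 : (ρ⁻¹) ≠ 0 := by positivity
    have c2 : ((2 * h)⁻¹) ≠ 0 := by positivity
    ext i
    fin_cases i
    · exact (mul_left_cancel₀ c1 h0).symm
    · exact (mul_left_cancel₀ c1 h1).symm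
    · exact (mul_left_cancel₀ c2 (add_right_cancel h2)).symm
  refine ⟨f, hinj.injOn, image_eq_of_extremePoints hSc hS isCompact_cylinder convex_cylinder ?_ ?_⟩
  · rintro _ ⟨p, hp, rfl⟩
    obtain ⟨H1, H2⟩ := (hiff p).1 hp
    refine ⟨H1.le, ?_⟩
    rcases H2 with H2 | H2 <;> simp [H2]
  · intro q hq
    obtain ⟨p, rfl⟩ := hsurj q
    exact ⟨p, (hiff p).2 (extremePoints_cylinder_subset hq), rfl⟩

section Normalization

open MeasureTheory

variable {W : Type*} [NormedAddCommGroup W] [InnerProductSpace ℝ W]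
  [MeasurableSpace W] [BorelSpace W] (μ : Measure W)

/-- An affine bijection preserving a set of positive finite measure preserves the measure
restricted to that set. -/
lemma measurePreserving_restrict_of_image_eq [FiniteDimensional ℝ W] [μ.IsAddHaarMeasure]
    {T : Set W} (hT : MeasurableSet T) (h0 : μ T ≠ 0) (htop : μ T ≠ ⊤) (f : W ≃ᵃ[ℝ] W)
    (hf : f '' T = T) : MeasurePreserving f (μ.restrict T) (μ.restrict T) := by
  have hmeas : Measurable f := (f.toAffineMap.continuous_of_finiteDimensional).measurable
  have hpre : f ⁻¹' T = T := by
    conv_lhs => rw [← hf]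
    exact preimage_image_eq _ f.injective
  have hdet : LinearMap.det (f.linear : W →ₗ[ℝ] W) ≠ 0 := f.linear.isUnit_det'.ne_zero
  obtain ⟨c, hc⟩ : ∃ c : ENNReal, μ.map f = c • μ := by
    refine ⟨ENNReal.ofReal |(LinearMap.det (f.linear : W →ₗ[ℝ] W))⁻¹|, ?_⟩
    have hfun : (f : W → W) = (fun x => x + f 0) ∘ (f.linear : W →ₗ[ℝ] W) := by
      ext x
      have := f.map_vadd 0 x
      simpa using this
    rw [hfun, ← Measure.map_map (by fun_prop)
      ((f.linear : W →ₗ[ℝ] W).continuous_of_finiteDimensional.measurable),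
      Measure.map_linearMap_addHaar_eq_smul_addHaar μ hdet, Measure.map_smul,
      map_add_right_eq_self]
  have hc1 : c = 1 := by
    have h1 : μ.map f T = μ T := by rw [Measure.map_apply hmeas hT, hpre]
    rw [hc, Measure.smul_apply, smul_eq_mul] at h1
    exact (ENNReal.mul_eq_right h0 htop).1 h1
  have hmp : MeasurePreserving f μ μ := ⟨hmeas, by rw [hc, hc1, one_smul]⟩
  have := hmp.restrict_preimage hT
  rwa [hpre] at this

lemma integral_comp_of_image_eq [FiniteDimensional ℝ W] [μ.IsAddHaarMeasure] {G : Type*}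
    [NormedAddCommGroup G] [NormedSpace ℝ G] {T : Set W}
    (hT : MeasurableSet T) (h0 : μ T ≠ 0) (htop : μ T ≠ ⊤) (f : W ≃ᵃ[ℝ] W) (hf : f '' T = T)
    (F : W → G) : ∫ x in T, F (f x) ∂μ = ∫ x in T, F x ∂μ := by
  have hemb : MeasurableEmbedding f :=
    (AffineEquiv.toContinuousAffineEquiv f).toHomeomorph.measurableEmbedding
  exact (measurePreserving_restrict_of_image_eq μ hT h0 htop f hf).integral_comp hemb F

/-- The centroid of `T`. -/
def centroidOf (T : Set W) : W := (μ.real T)⁻¹ • ∫ x in T, x ∂μ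

/-- The covariance operator of `T`. -/
def covarianceOf (T : Set W) : W →L[ℝ] W :=
  ∫ x in T, InnerProductSpace.rankOne ℝ (x - centroidOf μ T) (x - centroidOf μ T) ∂μ

lemma apply_centroidOf [FiniteDimensional ℝ W] [μ.IsAddHaarMeasure] {T : Set W}
    (hT : IsCompact T) (h0 : μ T ≠ 0) (f : W ≃ᵃ[ℝ] W) (hf : f '' T = T) :
    f (centroidOf μ T) = centroidOf μ T := by
  have htop : μ T ≠ ⊤ := hT.measure_lt_top.ne
  have hm : μ.real T ≠ 0 := (ENNReal.toReal_pos h0 htop).ne'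
  obtain ⟨L, b, hfx⟩ : ∃ (L : W →L[ℝ] W) (b : W), ∀ x, f x = L x + b :=
    ⟨(f.linear : W →ₗ[ℝ] W).toContinuousLinearMap, f 0, fun x => by
      simpa using f.map_vadd 0 x⟩
  have h1 := integral_comp_of_image_eq μ hT.measurableSet h0 htop f hf id
  have hint : IntegrableOn (fun x : W => x) T μ :=
    ContinuousOn.integrableOn_compact hT continuousOn_id
  simp only [id, hfx] at h1
  have hLint : IntegrableOn (fun x => L x) T μ := L.integrable_comp hint
  have hbint : IntegrableOn (fun _ => b) T μ := integrableOn_const htop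
  rw [integral_add hLint hbint, ContinuousLinearMap.integral_comp_comm _ hint,
    setIntegral_const] at h1
  rw [hfx, centroidOf, map_smul]
  conv_rhs => rw [← h1]
  rw [smul_add, smul_smul, inv_mul_cancel₀ hm, one_smul]

lemma integrableOn_rankOne [IsFiniteMeasureOnCompacts μ] {T : Set W} (hT : IsCompact T) (c : W) :
    IntegrableOn (fun x : W => InnerProductSpace.rankOne ℝ (x - c) (x - c)) T μ := by
  refine ContinuousOn.integrableOn_compact hT ?_
  have : Continuous fun x : W => InnerProductSpace.rankOne ℝ (x - c) (x - c) := by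
    have h : Continuous fun x : W => x - c := by fun_prop
    exact ((InnerProductSpace.rankOne ℝ).continuous.comp h).clm_apply h
  exact this.continuousOn

lemma conj_covarianceOf [FiniteDimensional ℝ W] [CompleteSpace W] [μ.IsAddHaarMeasure] {T : Set W}
    (hT : IsCompact T) (h0 : μ T ≠ 0) (f : W ≃ᵃ[ℝ] W) (hf : f '' T = T) (L : W →L[ℝ] W)
    (hL : ∀ x y, f x - f y = L (x - y)) :
    L * covarianceOf μ T * star L = covarianceOf μ T := by
  have hint := integrableOn_rankOne μ hT (centroidOf μ T)
  have h1 := (ContinuousLinearMap.mulLeftRight ℝ (W →L[ℝ] W) L (star L)).integral_comp_comm hint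
  simp only [ContinuousLinearMap.mulLeftRight_apply] at h1
  rw [covarianceOf, ← h1]
  conv_rhs => rw [← integral_comp_of_image_eq μ hT.measurableSet h0 hT.measure_lt_top.ne f hf]
  refine integral_congr_ae (Eventually.of_forall fun x => ?_)
  have h2 : f x - centroidOf μ T = L (x - centroidOf μ T) := by
    rw [← hL, apply_centroidOf μ hT h0 f hf]
  ext y
  simp only [h2, mul_apply_eq_comp, InnerProductSpace.rankOne_apply, map_smul]
  rw [ContinuousLinearMap.star_eq_adjoint, ContinuousLinearMap.adjoint_inner_right]

lemma inner_covarianceOf [CompleteSpace W] [IsFiniteMeasureOnCompacts μ] {T : Set W}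
    (hT : IsCompact T) (y z : W) :
    inner ℝ (covarianceOf μ T y) z =
      ∫ x in T, inner ℝ (x - centroidOf μ T) y * inner ℝ (x - centroidOf μ T) z ∂μ := by
  have hint := integrableOn_rankOne μ hT (centroidOf μ T)
  rw [covarianceOf, ContinuousLinearMap.integral_apply hint, real_inner_comm]
  rw [← integral_inner (hint.apply_continuousLinearMap y)]
  refine integral_congr_ae (Eventually.of_forall fun x => ?_)
  simp only [InnerProductSpace.rankOne_apply, real_inner_smul_right, real_inner_comm]

lemma covarianceOf_pos [FiniteDimensional ℝ W] [CompleteSpace W] [μ.IsAddHaarMeasure] {T : Set W}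
    (hT : IsCompact T) (hint : (interior T).Nonempty) {y : W} (hy : y ≠ 0) :
    0 < inner ℝ (covarianceOf μ T y) y := by
  rw [inner_covarianceOf μ hT]
  have hcont : Continuous fun x : W =>
      inner ℝ (x - centroidOf μ T) y * inner ℝ (x - centroidOf μ T) y := by fun_prop
  have hnn : 0 ≤ᵐ[μ.restrict T] fun x : W =>
      inner ℝ (x - centroidOf μ T) y * inner ℝ (x - centroidOf μ T) y :=
    Eventually.of_forall fun x => mul_self_nonneg _
  rw [integral_pos_iff_support_of_nonneg_ae hnn (hcont.continuousOn.integrableOn_compact hT),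
    Measure.restrict_apply hcont.isOpen_support.measurableSet]
  refine lt_of_lt_of_le ?_ (measure_mono (inter_subset_inter_right _ interior_subset))
  refine (hcont.isOpen_support.inter isOpen_interior).measure_pos μ ?_
  by_contra hempty
  rw [not_nonempty_iff_eq_empty] at hempty
  have hsub : interior T ⊆ {p | inner ℝ p y = inner ℝ (centroidOf μ T) y} := by
    intro p hp
    by_contra hne
    refine eq_empty_iff_forall_notMem.1 hempty p ⟨?_, hp⟩
    simpa [Function.mem_support, inner_sub_left, sub_eq_zero] using hne
  obtain ⟨p, hp⟩ := hint
  have : p ∈ interior {p : W | inner ℝ p y = inner ℝ (centroidOf μ T) y} :=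
    interior_maximal hsub isOpen_interior hp
  rw [interior_hyperplane_eq_empty hy] at this
  exact this

end Normalization

open scoped MatrixOrder in
lemma exists_mul_star_eq {M : V3 →L[ℝ] V3}
    (hsymm : ∀ x y, inner ℝ (M x) y = inner ℝ (M y) x)
    (hpos : ∀ x ≠ 0, 0 < inner ℝ (M x) x) :
    ∃ N : (V3 →L[ℝ] V3)ˣ, M = N * star (N : V3 →L[ℝ] V3) := by
  set Ψ := Matrix.toEuclideanCLM (n := Fin 3) (𝕜 := ℝ)
  set m := Ψ.symm M
  have hΨ : Ψ m = M := Ψ.apply_symm_apply M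
  have hd : m.PosDef := by
    rw [Matrix.posDef_iff_dotProduct_mulVec]
    constructor
    · have : star M = M := by
        rw [ContinuousLinearMap.star_eq_adjoint]
        symm
        rw [ContinuousLinearMap.eq_adjoint_iff]
        intro x y
        rw [hsymm, real_inner_comm]
      change star m = m
      refine (EquivLike.injective Ψ) ?_
      rw [map_star, hΨ, this]
    · intro x hx
      have h1 := hpos (WithLp.toLp 2 x) (by simpa using hx)
      rw [real_inner_comm, ← hΨ, Matrix.inner_toEuclideanCLM] at h1
      simpa using h1
  obtain ⟨y, hy, hmy⟩ := CStarAlgebra.isStrictlyPositive_iff_eq_star_mul_self.mp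
    hd.isStrictlyPositive
  have hu : IsUnit (Ψ (star y)) := (hy.star).map Ψ
  refine ⟨hu.unit, ?_⟩
  rw [IsUnit.unit_spec, ← map_star, star_star, ← map_mul, ← hmy, hΨ]

/-- A convex body has an affine image all of whose affine symmetries are linear isometries. -/
lemma exists_affineEquiv_isometries {T : Set V3} (hT : IsCompact T)
    (hint : (interior T).Nonempty) :
    ∃ Φ : V3 ≃ᵃ[ℝ] V3, ∀ f : V3 ≃ᵃ[ℝ] V3, f '' T = T →
      ∃ U ∈ unitary (V3 →L[ℝ] V3), ∀ x, Φ (f x) = U (Φ x) := by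
  set μ : MeasureTheory.Measure V3 := MeasureTheory.volume
  have h0 : μ T ≠ 0 := (MeasureTheory.Measure.measure_pos_of_nonempty_interior μ hint).ne'
  obtain ⟨N, hN⟩ := exists_mul_star_eq (M := covarianceOf μ T)
    (fun x y => by simp only [inner_covarianceOf μ hT, mul_comm])
    (fun x hx => covarianceOf_pos μ hT hint hx)
  set c := centroidOf μ T
  set e : V3 ≃L[ℝ] V3 := ContinuousLinearEquiv.unitsEquiv ℝ V3 N⁻¹
  have he : ∀ x, e x = (↑N⁻¹ : V3 →L[ℝ] V3) x := fun x => rfl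
  refine ⟨(AffineEquiv.constVAdd ℝ V3 (-c)).trans e.toLinearEquiv.toAffineEquiv, fun f hf => ?_⟩
  set L : V3 →L[ℝ] V3 := (f.linear : V3 →ₗ[ℝ] V3).toContinuousLinearMap
  have hL : ∀ x y, f x - f y = L (x - y) := fun x y => (f.toAffineMap.linearMap_vsub x y).symm
  have hconj := conj_covarianceOf μ hT h0 f hf L hL
  have hΦ : ∀ x, ((AffineEquiv.constVAdd ℝ V3 (-c)).trans e.toLinearEquiv.toAffineEquiv) x
      = (↑N⁻¹ : V3 →L[ℝ] V3) (x - c) := fun x => by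
    simp [he, sub_eq_neg_add]
  set U : V3 →L[ℝ] V3 := ↑N⁻¹ * L * ↑N with hU
  have hUU : U * star U = 1 := by
    have h1 : U * star U
        = ↑N⁻¹ * (L * (↑N * star (N : V3 →L[ℝ] V3)) * star L) * star (↑N⁻¹ : V3 →L[ℝ] V3) := by
      simp only [hU, star_mul, mul_assoc]
    rw [h1, ← hN, hconj, hN, ← mul_assoc, Units.inv_mul, one_mul, ← star_mul, Units.inv_mul,
      star_one]
  have hUU' : star U * U = 1 := by
    have h1 : (U : V3 →ₗ[ℝ] V3) * (star U : V3 →L[ℝ] V3) = 1 :=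
      congrArg ContinuousLinearMap.toLinearMap hUU
    exact ContinuousLinearMap.coe_injective (mul_eq_one_comm.1 h1)
  refine ⟨U, Unitary.mem_iff.2 ⟨hUU', hUU⟩, fun x => ?_⟩
  rw [hΦ, hΦ]
  have h2 : f x - c = L (x - c) := by rw [← hL, apply_centroidOf μ hT h0 f hf]
  rw [h2, hU, mul_apply_eq_comp, mul_apply_eq_comp, ← mul_apply_eq_comp (N : V3 →L[ℝ] V3),
    Units.mul_inv]
  rfl

section Transfer

variable {E F : Type*} [NormedAddCommGroup E] [NormedSpace ℝ E] [NormedAddCommGroup F]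
  [NormedSpace ℝ F]

lemma mem_extremePoints_image_iff {S : Set E} (hS : Convex ℝ S) {f : E →ᵃ[ℝ] F}
    (hf : InjOn f S) {p : E} (hp : p ∈ S) :
    f p ∈ extremePoints ℝ (f '' S) ↔ p ∈ extremePoints ℝ S := by
  constructor
  · refine fun h => ⟨hp, fun x hx y hy hxy => hf hx hp ?_⟩
    refine h.2 (mem_image_of_mem f hx) (mem_image_of_mem f hy) ?_
    rw [← image_openSegment]
    exact mem_image_of_mem f hxy
  · refine fun h => ⟨mem_image_of_mem f hp, ?_⟩
    rintro _ ⟨x, hx, rfl⟩ _ ⟨y, hy, rfl⟩ hxy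
    rw [← image_openSegment] at hxy
    obtain ⟨z, hz, hzp⟩ := hxy
    obtain rfl : z = p := hf (hS.openSegment_subset hx hy hz) hp hzp
    rw [h.2 hx hy hz]

lemma extremePoints_image {S : Set E} (hS : Convex ℝ S) {f : E →ᵃ[ℝ] F} (hf : InjOn f S) :
    extremePoints ℝ (f '' S) = f '' extremePoints ℝ S := by
  ext q
  constructor
  · intro hq
    obtain ⟨p, hp, rfl⟩ := hq.1
    exact mem_image_of_mem f ((mem_extremePoints_image_iff hS hf hp).1 hq)
  · rintro ⟨p, hp, rfl⟩
    exact (mem_extremePoints_image_iff hS hf hp.1).2 hp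

lemma AffIso.trans {G : Type*} [NormedAddCommGroup G] [NormedSpace ℝ G] {S : Set E} {T : Set F}
    {R : Set G} (h₁ : AffIso S T) (h₂ : AffIso T R) : AffIso S R := by
  obtain ⟨f, hf, rfl⟩ := h₁
  obtain ⟨g, hg, rfl⟩ := h₂
  exact ⟨g.comp f, hg.comp hf (mapsTo_image f S), by rw [AffineMap.coe_comp, image_comp]⟩

/-- An affine map from a set with 3-dimensional affine hull onto a spanning set of the space has an
affine section that inverts it on the set. -/
lemma exists_affine_section {S : Set E}
    (hdim : Module.finrank ℝ (affineSpan ℝ S).direction = 3) {f : E →ᵃ[ℝ] V3}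
    (hspan : affineSpan ℝ (f '' S) = ⊤) :
    ∃ s : V3 →ᵃ[ℝ] E, (∀ v, f (s v) = v) ∧ ∀ x ∈ S, s (f x) = x := by
  obtain ⟨x₀, hx₀⟩ : S.Nonempty :=
    image_nonempty.1 (AffineSubspace.nonempty_of_affineSpan_eq_top ℝ V3 V3 hspan)
  rw [direction_affineSpan] at hdim
  have hmap : (vectorSpan ℝ S).map f.linear = ⊤ := by
    rw [AffineMap.map_vectorSpan]
    exact AffineSubspace.vectorSpan_eq_top_of_affineSpan_eq_top ℝ V3 V3 hspan
  have hfin : FiniteDimensional ℝ (vectorSpan ℝ S) :=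
    FiniteDimensional.of_finrank_pos (by rw [hdim]; norm_num)
  have hsurj : Function.Surjective (f.linear.domRestrict (vectorSpan ℝ S)) := by
    intro v
    obtain ⟨x, hx, rfl⟩ : v ∈ (vectorSpan ℝ S).map f.linear := hmap ▸ Submodule.mem_top
    exact ⟨⟨x, hx⟩, rfl⟩
  have hinj := (LinearMap.injective_iff_surjective_of_finrank_eq_finrank
    (by rw [hdim]; simp)).2 hsurj
  set e := LinearEquiv.ofBijective _ ⟨hinj, hsurj⟩
  have hfe : ∀ v, f.linear (e.symm v) = v := fun v => e.apply_symm_apply v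
  refine ⟨((vectorSpan ℝ S).subtype ∘ₗ e.symm.toLinearMap).toAffineMap.comp
    (AffineEquiv.constVAdd ℝ V3 (-f x₀)).toAffineMap + AffineMap.const ℝ V3 x₀, ?_, ?_⟩
  · intro v
    have := f.map_vadd x₀ (e.symm (-f x₀ + v) : E)
    simp only [vadd_eq_add, hfe] at this
    simpa using this
  · intro x hx
    have hxm : x - x₀ ∈ vectorSpan ℝ S := vsub_mem_vectorSpan ℝ hx hx₀
    have h1 : e ⟨x - x₀, hxm⟩ = -f x₀ + f x := by
      change f.linear (x - x₀) = _
      rw [← vsub_eq_sub x x₀, f.linearMap_vsub, vsub_eq_sub, sub_eq_neg_add]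
    have h2 : e.symm (-f x₀ + f x) = ⟨x - x₀, hxm⟩ := by rw [← h1, e.symm_apply_apply]
    simp [h2]

lemma autTransitiveOnExtreme_image_iff {S : Set E} (hS : Convex ℝ S) {f : E →ᵃ[ℝ] F}
    {s : F →ᵃ[ℝ] E} (hfs : ∀ v, f (s v) = v) (hsf : ∀ x ∈ S, s (f x) = x)
    (hspan : affineSpan ℝ (f '' S) = ⊤) :
    AutTransitiveOnExtreme S ↔ AutTransitiveOnExtreme (f '' S) := by
  have hinj : InjOn f S := fun x hx y hy hxy => by rw [← hsf x hx, hxy, hsf y hy]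
  rw [AutTransitiveOnExtreme, AutTransitiveOnExtreme, extremePoints_image hS hinj]
  simp only [forall_mem_image]
  refine forall₂_congr fun a ha => forall₂_congr fun b hb => ⟨?_, ?_⟩
  · rintro ⟨g, hg, hab⟩
    have hgS : ∀ x ∈ S, g x ∈ S := fun x hx => hg ▸ mem_image_of_mem g hx
    have hgS' : ∀ x ∈ S, g.symm x ∈ S := fun x hx => by
      obtain ⟨y, hy, rfl⟩ := hg.symm ▸ hx
      rwa [g.symm_apply_apply]
    have h1 : ∀ x ∈ S, f (g (s (f x))) = f (g x) := fun x hx => by rw [hsf x hx]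
    have hl : ∀ k k' : E ≃ᵃ[ℝ] E, (∀ x, k' (k x) = x) → (∀ x ∈ S, k x ∈ S) →
        ∀ v, f (k' (s (f (k (s v))))) = v := by
      intro k k' hk hkS v
      have : (f.comp (k'.toAffineMap.comp s)).comp (f.comp (k.toAffineMap.comp s))
          = AffineMap.id ℝ F := by
        refine AffineMap.ext_on hspan ?_
        rintro _ ⟨x, hx, rfl⟩
        simp [hsf x hx, hsf _ (hkS x hx), hk]
      exact DFunLike.congr_fun this v
    refine ⟨AffineEquiv.ofBijective (φ := f.comp (g.toAffineMap.comp s))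
      (Function.bijective_iff_has_inverse.2 ⟨f.comp (g.symm.toAffineMap.comp s),
        hl g g.symm g.symm_apply_apply hgS, hl g.symm g g.apply_symm_apply hgS'⟩), ?_, ?_⟩
    · conv_rhs => rw [← hg]
      rw [image_image, image_image]
      exact image_congr h1
    · exact (h1 a ha.1).trans (by rw [hab])
  · rintro ⟨h, hh, hab⟩
    have hhS : ∀ x ∈ S, h (f x) ∈ f '' S := fun x hx =>
      hh ▸ mem_image_of_mem h (mem_image_of_mem f hx)
    let k : (F ≃ᵃ[ℝ] F) → (E →ᵃ[ℝ] E) := fun h =>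
      s.comp (h.toAffineMap.comp f) + (AffineMap.id ℝ E - s.comp f)
    have hk : ∀ h x, k h x = s (h (f x)) + (x - s (f x)) := fun h x => rfl
    have hfk : ∀ h x, f (k h x) = h (f x) := by
      intro h x
      have h1 := f.map_vadd (s (h (f x))) (x - s (f x))
      have h2 := f.linearMap_vsub x (s (f x))
      simp only [vsub_eq_sub, hfs, sub_self] at h2
      rw [h2] at h1
      simpa [hk, hfs, add_comm] using h1
    have hkk : ∀ h x, k h.symm (k h x) = x := by
      intro h x
      rw [hk h.symm, hfk, h.symm_apply_apply, hk]
      abel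
    have hkk' : ∀ x, k h (k h.symm x) = x := fun x => hkk h.symm x
    have hkS : ∀ x ∈ S, k h x = s (h (f x)) := fun x hx => by rw [hk, hsf x hx, sub_self, add_zero]
    refine ⟨AffineEquiv.ofBijective (φ := k h)
      (Function.bijective_iff_has_inverse.2 ⟨k h.symm, hkk h, hkk'⟩), ?_, ?_⟩
    · change k h '' S = S
      rw [image_congr hkS, ← image_image s, ← image_image h, hh, image_image, image_congr hsf,
        image_id']
    · change k h a = b
      rw [hkS a ha.1, hab, hsf b hb.1]

lemma AffIso.autTransitiveOnExtreme_iff {S : Set E} (hS : Convex ℝ S)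
    (hdim : Module.finrank ℝ (affineSpan ℝ S).direction = 3) {T : Set V3} (h : AffIso S T)
    (hspan : affineSpan ℝ T = ⊤) : AutTransitiveOnExtreme S ↔ AutTransitiveOnExtreme T := by
  obtain ⟨f, -, rfl⟩ := h
  obtain ⟨s, hfs, hsf⟩ := exists_affine_section hdim hspan
  exact autTransitiveOnExtreme_image_iff hS hfs hsf hspan

lemma exists_affIso_spanning {S : Set E}
    (hdim : Module.finrank ℝ (affineSpan ℝ S).direction = 3) :
    ∃ f : E →ᵃ[ℝ] V3, InjOn f S ∧ affineSpan ℝ (f '' S) = ⊤ := by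
  rw [direction_affineSpan] at hdim
  have hne : S.Nonempty := by
    by_contra hempty
    rw [not_nonempty_iff_eq_empty] at hempty
    rw [hempty, vectorSpan_empty, finrank_bot] at hdim
    exact absurd hdim (by norm_num)
  have hfin : FiniteDimensional ℝ (vectorSpan ℝ S) :=
    FiniteDimensional.of_finrank_pos (by rw [hdim]; norm_num)
  let e : vectorSpan ℝ S ≃ₗ[ℝ] V3 := LinearEquiv.ofFinrankEq _ _ (by rw [hdim]; simp)
  obtain ⟨g, hg⟩ := LinearMap.exists_extend e.toLinearMap
  have hge : ∀ x : vectorSpan ℝ S, g x = e x := fun x => LinearMap.congr_fun hg x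
  refine ⟨g.toAffineMap, fun x hx y hy hxy => ?_, ?_⟩
  · have hm : x - y ∈ vectorSpan ℝ S := vsub_mem_vectorSpan ℝ hx hy
    have h1 : e ⟨x - y, hm⟩ = 0 := by
      rw [← hge]
      simpa [sub_eq_zero] using hxy
    have h2 := congrArg Subtype.val ((LinearEquiv.map_eq_zero_iff e).1 h1)
    exact sub_eq_zero.1 h2
  · rw [AffineSubspace.affineSpan_eq_top_iff_vectorSpan_eq_top_of_nonempty ℝ V3 V3 (hne.image _),
      ← AffineMap.map_vectorSpan, eq_top_iff]
    exact fun v _ => ⟨e.symm v, (e.symm v).2, by simp [hge]⟩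

end Transfer

lemma autTransitiveOnExtreme_closedBall :
    AutTransitiveOnExtreme (Metric.closedBall (0 : V3) 1) := by
  intro x hx y hy
  have hx1 := extremePoints_closedBall_subset_sphere hx
  have hy1 := extremePoints_closedBall_subset_sphere hy
  rw [mem_sphere_zero_iff_norm] at hx1 hy1
  let g : V3 ≃ₗᵢ[ℝ] V3 := (ℝ ∙ (x - y))ᗮ.reflection
  exact ⟨g.toLinearEquiv.toAffineEquiv, by simp,
    Submodule.reflection_sub (hx1.trans hy1.symm)⟩

/-- The map acting on the horizontal plane by the symmetric matrix with rows `(a, b)`, `(b, -a)` and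
on the vertical axis by `z ↦ c * z + e`. -/
def cylinderMap (a b c e : ℝ) : V3 →ᵃ[ℝ] V3 :=
  LinearMap.toAffineMap
    { toFun := fun x => !₂[a * x 0 + b * x 1, b * x 0 - a * x 1, c * x 2]
      map_add' := fun x y => by ext i; fin_cases i <;> simp <;> ring
      map_smul' := fun t x => by ext i; fin_cases i <;> simp <;> ring } +
    AffineMap.const ℝ V3 !₂[0, 0, e]

lemma cylinderMap_apply (a b c e : ℝ) (p : V3) :
    cylinderMap a b c e p = !₂[a * p 0 + b * p 1, b * p 0 - a * p 1, c * p 2 + e] := by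
  ext i
  fin_cases i <;> simp [cylinderMap]

lemma exists_affineEquiv_cylinderMap {a b c e : ℝ} (hab : a ^ 2 + b ^ 2 = 1)
    (hce : (c = 1 ∧ e = 0) ∨ (c = -1 ∧ e = 1)) :
    ∃ f : V3 ≃ᵃ[ℝ] V3, f '' {p : V3 | p 0 ^ 2 + p 1 ^ 2 ≤ 1 ∧ p 2 ∈ Icc (0 : ℝ) 1} =
      {p : V3 | p 0 ^ 2 + p 1 ^ 2 ≤ 1 ∧ p 2 ∈ Icc (0 : ℝ) 1} ∧
      ∀ p, f p = cylinderMap a b c e p := by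
  have hinv : Function.Involutive (cylinderMap a b c e) := by
    intro p
    rw [cylinderMap_apply, cylinderMap_apply]
    ext i
    fin_cases i
    · simp
      linear_combination p 0 * hab
    · simp
      linear_combination p 1 * hab
    · rcases hce with ⟨rfl, rfl⟩ | ⟨rfl, rfl⟩ <;> simp
  have hmaps : MapsTo (cylinderMap a b c e)
      {p : V3 | p 0 ^ 2 + p 1 ^ 2 ≤ 1 ∧ p 2 ∈ Icc (0 : ℝ) 1}
      {p : V3 | p 0 ^ 2 + p 1 ^ 2 ≤ 1 ∧ p 2 ∈ Icc (0 : ℝ) 1} := by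
    rintro p ⟨hp, hp0, hp1⟩
    rw [cylinderMap_apply]
    refine ⟨?_, ?_⟩
    · simp
      have : (a * p 0 + b * p 1) ^ 2 + (b * p 0 - a * p 1) ^ 2 = p 0 ^ 2 + p 1 ^ 2 := by
        linear_combination (p 0 ^ 2 + p 1 ^ 2) * hab
      rwa [this]
    · rcases hce with ⟨rfl, rfl⟩ | ⟨rfl, rfl⟩ <;> simp <;> constructor <;> linarith
  refine ⟨AffineEquiv.ofBijective hinv.bijective, ?_, fun p => rfl⟩
  refine Subset.antisymm (image_subset_iff.2 hmaps) fun p hp => ?_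
  exact ⟨cylinderMap a b c e p, hmaps hp, hinv p⟩

lemma autTransitiveOnExtreme_cylinder :
    AutTransitiveOnExtreme {p : V3 | p 0 ^ 2 + p 1 ^ 2 ≤ 1 ∧ p 2 ∈ Icc (0 : ℝ) 1} := by
  intro x hx y hy
  obtain ⟨hx1, hx2⟩ := extremePoints_cylinder_subset hx
  obtain ⟨hy1, hy2⟩ := extremePoints_cylinder_subset hy
  obtain ⟨c, e, hce, hz⟩ : ∃ c e : ℝ, ((c = 1 ∧ e = 0) ∨ (c = -1 ∧ e = 1)) ∧
      c * x 2 + e = y 2 := by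
    by_cases h : x 2 = y 2
    · exact ⟨1, 0, Or.inl ⟨rfl, rfl⟩, by rw [h]; ring⟩
    · refine ⟨-1, 1, Or.inr ⟨rfl, rfl⟩, ?_⟩
      rcases hx2 with h1 | h1 <;> rcases hy2 with h2 | h2 <;> simp_all
  obtain ⟨f, hf, hfp⟩ := exists_affineEquiv_cylinderMap
    (a := x 0 * y 0 - x 1 * y 1) (b := x 0 * y 1 + x 1 * y 0)
    (by linear_combination (y 0 ^ 2 + y 1 ^ 2) * hx1 + hy1) hce
  refine ⟨f, hf, ?_⟩
  rw [hfp, cylinderMap_apply]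
  ext i
  fin_cases i
  · simp
    linear_combination y 0 * hx1
  · simp
    linear_combination y 1 * hx1
  · simpa using hz

lemma affineSpan_closedBall : affineSpan ℝ (Metric.closedBall (0 : V3) 1) = ⊤ := by
  rw [eq_top_iff, ← Metric.isOpen_ball.affineSpan_eq_top
    (Metric.nonempty_ball.2 one_pos : (Metric.ball (0 : V3) 1).Nonempty)]
  exact affineSpan_mono ℝ Metric.ball_subset_closedBall

lemma affineSpan_cylinder :
    affineSpan ℝ {p : V3 | p 0 ^ 2 + p 1 ^ 2 ≤ 1 ∧ p 2 ∈ Icc (0 : ℝ) 1} = ⊤ := by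
  have hopen : IsOpen {p : V3 | p 0 ^ 2 + p 1 ^ 2 < 1 ∧ p 2 ∈ Ioo (0 : ℝ) 1} :=
    (isOpen_lt (f := fun p : V3 => p 0 ^ 2 + p 1 ^ 2) (by fun_prop) continuous_const).inter
      (isOpen_Ioo.preimage (f := fun p : V3 => p 2) (by fun_prop))
  rw [eq_top_iff, ← hopen.affineSpan_eq_top ⟨!₂[0, 0, 1 / 2], by simp, by simp; norm_num⟩]
  exact affineSpan_mono ℝ fun p hp => ⟨hp.1.le, hp.2.1.le, hp.2.2.le⟩

/-- Classification of the three-dimensional bodies with infinitely many extreme points. -/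
lemma affIso_cylinder_or_closedBall {T : Set V3} (hc : IsCompact T) (hconv : Convex ℝ T)
    (hspan : affineSpan ℝ T = ⊤) (haut : AutTransitiveOnExtreme T)
    (hinf : (extremePoints ℝ T).Infinite) :
    AffIso T {p : V3 | p 0 ^ 2 + p 1 ^ 2 ≤ 1 ∧ p 2 ∈ Icc (0 : ℝ) 1} ∨
      AffIso T (Metric.closedBall (0 : V3) 1) := by
  obtain ⟨Φ, hΦ⟩ := exists_affineEquiv_isometries hc
    (hconv.interior_nonempty_iff_affineSpan_eq_top.2 hspan)
  have hinj : InjOn Φ.toAffineMap T := Φ.injective.injOn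
  have hiso : AffIso T (Φ.toAffineMap '' T) := ⟨Φ.toAffineMap, hinj, rfl⟩
  have hext := extremePoints_image hconv hinj
  have hc' : IsCompact (Φ.toAffineMap '' T) :=
    hc.image Φ.toAffineMap.continuous_of_finiteDimensional
  have hconv' : Convex ℝ (Φ.toAffineMap '' T) := hconv.affine_image _
  have hspan' : affineSpan ℝ (Φ.toAffineMap '' T) = ⊤ :=
    (AffineEquiv.span_eq_top_iff Φ).1 hspan
  have htrans : IsometryTransitive (Φ.toAffineMap '' T) := by
    rw [IsometryTransitive, hext]
    rintro _ ⟨x, hx, rfl⟩ _ ⟨y, hy, rfl⟩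
    obtain ⟨f, hf, hfx⟩ := haut x hx y hy
    obtain ⟨U, hU, hUf⟩ := hΦ f hf
    refine ⟨U, ⟨hU, ?_, ?_⟩, ?_⟩
    · rintro _ ⟨z, hz, rfl⟩
      exact ⟨f z, hf ▸ mem_image_of_mem f hz, hUf z⟩
    · rintro _ ⟨z, hz, rfl⟩
      obtain ⟨w, hw, rfl⟩ := hf.symm ▸ hz
      refine ⟨w, hw, ?_⟩
      change Φ w = star U (Φ (f w))
      rw [hUf, star_apply_apply hU]
    · change U (Φ x) = Φ y
      rw [← hUf, hfx]
  have hinf' : (extremePoints ℝ (Φ.toAffineMap '' T)).Infinite := by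
    rw [hext]
    exact hinf.image (hinj.mono extremePoints_subset)
  rcases htrans.sphere_or_circles hc' hconv' hspan' hinf' with
    ⟨r, hr, h⟩ | ⟨u, r, h, hu, hh, hr, hX⟩
  · exact Or.inr (hiso.trans (affIso_closedBall_of_extremePoints_eq_sphere hc' hconv' hr h))
  · exact Or.inl (hiso.trans
      (affIso_cylinder_of_extremePoints_eq_circles hc' hconv' hu hh hr hX))

/-- Theorem: a compact convex set with 3-dimensional affine hull has a vertex-transitive affine
automorphism action on extreme points iff it is affinely isomorphic to a 3-dimensional
vertex-transitive polytope, the circular cylinder, or the closed unit ball. -/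
theorem three_dimensional_symmetric {d : ℕ} (S : Set (EuclideanSpace ℝ (Fin d)))
    (hScompact : IsCompact S) (hSconvex : Convex ℝ S)
    (hdim : Module.finrank ℝ (affineSpan ℝ S).direction = 3) :
    AutTransitiveOnExtreme S ↔
      ((∃ P : Set (EuclideanSpace ℝ (Fin 3)),
          (∃ t : Finset (EuclideanSpace ℝ (Fin 3)), P = convexHull ℝ (t : Set (EuclideanSpace ℝ (Fin 3)))) ∧
          affineSpan ℝ P = ⊤ ∧ AutTransitiveOnExtreme P ∧ AffIso S P) ∨
       AffIso S {p : EuclideanSpace ℝ (Fin 3) | p 0 ^ 2 + p 1 ^ 2 ≤ 1 ∧ p 2 ∈ Set.Icc (0 : ℝ) 1} ∨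
       AffIso S (Metric.closedBall (0 : EuclideanSpace ℝ (Fin 3)) 1)) := by
  constructor
  · intro haut
    obtain ⟨f, hinj, hspan⟩ := exists_affIso_spanning hdim
    have hiso : AffIso S (f '' S) := ⟨f, hinj, rfl⟩
    have hc : IsCompact (f '' S) := hScompact.image f.continuous_of_finiteDimensional
    have hconv : Convex ℝ (f '' S) := hSconvex.affine_image f
    have haut' := (hiso.autTransitiveOnExtreme_iff hSconvex hdim hspan).1 haut
    by_cases hfin : (Set.extremePoints ℝ (f '' S)).Finite
    · refine Or.inl ⟨f '' S, ⟨hfin.toFinset, ?_⟩, hspan, haut', hiso⟩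
      rw [hfin.coe_toFinset, ← (hfin.isClosed_convexHull ℝ).closure_eq,
        closure_convexHull_extremePoints hc hconv]
    · exact Or.inr ((affIso_cylinder_or_closedBall hc hconv hspan haut' hfin).imp
        hiso.trans hiso.trans)
  · rintro (⟨P, -, hspan, haut, hiso⟩ | hiso | hiso)
    · exact (hiso.autTransitiveOnExtreme_iff hSconvex hdim hspan).2 haut
    · exact (hiso.autTransitiveOnExtreme_iff hSconvex hdim affineSpan_cylinder).2
        autTransitiveOnExtreme_cylinder
    · exact (hiso.autTransitiveOnExtreme_iff hSconvex hdim affineSpan_closedBall).2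
        autTransitiveOnExtreme_closedBall
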